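/- arXiv:2108.09406 — 8 statements merged into one kernel-verified Lean document; each statement's English description precedes it below -/
import Mathlib

section
/- Consider the linear time-varying system x'(t) = A(t)x(t) + b(t) with output y(t) = C(t)ᵀx(t), and the GPEBO dynamics ξ'(t) = A(t)ξ(t) + b(t) and Φ_A'(t) = A(t)Φ_A(t) with Φ_A(0) = Iₙ. Then, setting θ := x(0) − ξ(0), for every t ≥ 0 one has x(t) = ξ(t) + Φ_A(t)θ, and consequently the measurable signals 𝒴(t) := y(t) − C(t)ᵀξ(t) and ψ(t) := Φ_A(t)ᵀC(t) satisfy the linear regression equation 𝒴(t) = ψ(t)ᵀθ for all t ≥ 0. -/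
open Matrix

/-- A solution of `z' = A z` on `[0, ∞)` with `A` continuous and `z 0 = 0` vanishes. -/
theorem eq_zero_of_hasDerivAt_mulVec {ι : Type*} [Fintype ι]
    {A : ℝ → Matrix ι ι ℝ} (hA : Continuous A) {z : ℝ → ι → ℝ}
    (hz : ∀ t ≥ (0 : ℝ), HasDerivAt z (A t *ᵥ z t) t) (hz0 : z 0 = 0) :
    ∀ t ≥ (0 : ℝ), z t = 0 := by
  intro t ht
  have hsum : Continuous fun s => ∑ i, ∑ j, |A s i j| := by fun_prop
  obtain ⟨K, hK⟩ := isCompact_Icc.bddAbove_image (hsum.continuousOn (s := Set.Icc 0 t))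
  refine eq_zero_of_abs_deriv_le_mul_abs_self_of_eq_zero_right (K := K) (a := 0) (b := t)
    (f := z) (f' := fun s => A s *ᵥ z s)
    (fun s hs => (hz s hs.1).continuousAt.continuousWithinAt)
    (fun s hs => (hz s hs.1).hasDerivWithinAt) hz0 ?_ t ⟨ht, le_rfl⟩
  intro s hs
  have hKs : ∑ i, ∑ j, |A s i j| ≤ K := hK ⟨s, ⟨hs.1, hs.2.le⟩, rfl⟩
  refine le_trans ?_ (mul_le_mul_of_nonneg_right hKs (norm_nonneg _))
  refine (pi_norm_le_iff_of_nonneg (by positivity)).2 fun i => ?_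
  calc ‖(A s *ᵥ z s) i‖ ≤ ∑ j, ‖A s i j * z s j‖ := norm_sum_le _ _
    _ ≤ ∑ j, |A s i j| * ‖z s‖ := by
        refine Finset.sum_le_sum fun j _ => ?_
        rw [norm_mul, Real.norm_eq_abs]
        gcongr
        exact norm_le_pi_norm _ j
    _ = (∑ j, |A s i j|) * ‖z s‖ := by rw [Finset.sum_mul]
    _ ≤ (∑ i, ∑ j, |A s i j|) * ‖z s‖ := by
        refine mul_le_mul_of_nonneg_right ?_ (norm_nonneg _)
        exact Finset.single_le_sum (f := fun i => ∑ j, |A s i j|)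
          (fun _ _ => Finset.sum_nonneg fun _ _ => abs_nonneg _) (Finset.mem_univ i)

/-- If `Φ' = A Φ` entrywise at `t`, then `Φ θ` satisfies `z' = A z` at `t`. -/
theorem hasDerivAt_mulVec_of_entries {ι : Type*} [Fintype ι]
    {A Φ : ℝ → Matrix ι ι ℝ} {t : ℝ}
    (hΦ : ∀ i j, HasDerivAt (fun s => Φ s i j) ((A t * Φ t) i j) t) (θ : ι → ℝ) :
    HasDerivAt (fun s => Φ s *ᵥ θ) (A t *ᵥ (Φ t *ᵥ θ)) t := by
  rw [mulVec_mulVec, hasDerivAt_pi]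
  intro i
  exact HasDerivAt.fun_sum fun j _ => (hΦ i j).mul_const (θ j)

/-- GPEBO linear regression equation: with `θ := x 0 - ξ 0`, the state satisfies
`x t = ξ t + Φ_A t θ` and the measurable signals `𝒴 = y - Cᵀξ`, `ψ = Φ_Aᵀ C`
satisfy the LRE `𝒴 = ψᵀ θ` for all `t ≥ 0`. -/
theorem gpebo_lre (n : ℕ) (hn : 1 ≤ n)
    (A : ℝ → Matrix (Fin n) (Fin n) ℝ) (b C : ℝ → Fin n → ℝ)
    (hA : Continuous A) (hb : Continuous b) (hC : Continuous C)
    (x ξ : ℝ → Fin n → ℝ) (Φ : ℝ → Matrix (Fin n) (Fin n) ℝ)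
    (y : ℝ → ℝ) (hy : ∀ t, y t = C t ⬝ᵥ x t)
    (hx : ∀ t ≥ (0 : ℝ), HasDerivAt x (A t *ᵥ x t + b t) t)
    (hξ : ∀ t, HasDerivAt ξ (A t *ᵥ ξ t + b t) t)
    (hΦ : ∀ t, ∀ i j, HasDerivAt (fun s => Φ s i j) ((A t * Φ t) i j) t)
    (hΦ0 : Φ 0 = 1) :
    ∀ t ≥ (0 : ℝ),
      x t = ξ t + Φ t *ᵥ (x 0 - ξ 0) ∧
      y t - C t ⬝ᵥ ξ t = ((Φ t)ᵀ *ᵥ C t) ⬝ᵥ (x 0 - ξ 0) := by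
  intro t ht
  have hstate : x t = ξ t + Φ t *ᵥ (x 0 - ξ 0) := by
    have h := eq_zero_of_hasDerivAt_mulVec hA
      (z := fun s => x s - ξ s - Φ s *ᵥ (x 0 - ξ 0))
      (fun s hs => by
        refine (((hx s hs).fun_sub (hξ s)).fun_sub
          (hasDerivAt_mulVec_of_entries (hΦ s) (x 0 - ξ 0))).congr_deriv ?_
        rw [mulVec_sub (A s), mulVec_sub (A s)]
        abel)
      (by simp [hΦ0]) t ht
    rwa [sub_sub, sub_eq_zero] at h
  refine ⟨hstate, ?_⟩
  rw [hy, ← dotProduct_sub, mulVec_transpose, ← dotProduct_mulVec]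
  congr 1
  rw [hstate, add_sub_cancel_left]
end

section
/- Let ψ(t) := Φ_A(t)ᵀC(t) and define the observability Gramian W(0,T) := ∫₀ᵀ Φ_A(τ)ᵀC(τ)C(τ)ᵀΦ_A(τ) dτ = ∫₀ᵀ ψ(τ)ψ(τ)ᵀ dτ. Then the following are equivalent: (i) there exists T > 0 such that W(0,T) has rank n (observability); (ii) there exist time instants t₁, …, tₙ ≥ 0 such that the n×n matrix with columns ψ(t₁), …, ψ(tₙ) has rank n (identifiability of the linear regression equation). -/
open Matrix

/-- Observability Gramian `W(0,T) = ∫₀ᵀ ψ(τ)ψ(τ)ᵀ dτ` (entrywise). -/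
noncomputable def obsGram (n : ℕ) (ψ : ℝ → Fin n → ℝ) (T : ℝ) :
    Matrix (Fin n) (Fin n) ℝ :=
  Matrix.of fun i j => ∫ τ in (0:ℝ)..T, ψ τ i * ψ τ j

/-- Sample matrix whose `j`-th column is `ψ (t j)`. -/
def sampleMatrix (n : ℕ) (ψ : ℝ → Fin n → ℝ) (t : Fin n → ℝ) :
    Matrix (Fin n) (Fin n) ℝ :=
  Matrix.of fun i j => ψ (t j) i

theorem Matrix.rank_eq_iff_forall_mulVec_eq_zero {K : Type*} [Field K] {n : ℕ}
    (M : Matrix (Fin n) (Fin n) K) :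
    M.rank = n ↔ ∀ v, M *ᵥ v = 0 → v = 0 := by
  have h := M.mulVecLin.finrank_range_add_finrank_ker
  rw [Module.finrank_fin_fun] at h
  change M.rank + _ = n at h
  have hker : (∀ v, M *ᵥ v = 0 → v = 0) ↔ LinearMap.ker M.mulVecLin = ⊥ := by
    simp [LinearMap.ker_eq_bot']
  rw [hker, ← Submodule.finrank_eq_zero]
  omega

theorem obsGram_mulVec_apply {n : ℕ} {ψ : ℝ → Fin n → ℝ} (hψ : Continuous ψ) (T : ℝ)
    (v : Fin n → ℝ) (i : Fin n) :
    (obsGram n ψ T *ᵥ v) i = ∫ τ in (0:ℝ)..T, ψ τ i * (ψ τ ⬝ᵥ v) := by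
  simp only [obsGram, Matrix.mulVec, dotProduct, Matrix.of_apply, Finset.mul_sum]
  rw [intervalIntegral.integral_finsetSum
    fun j _ => Continuous.intervalIntegrable (by fun_prop) _ _]
  simp only [← mul_assoc, intervalIntegral.integral_mul_const]

theorem dotProduct_obsGram_mulVec {n : ℕ} {ψ : ℝ → Fin n → ℝ} (hψ : Continuous ψ) (T : ℝ)
    (v : Fin n → ℝ) :
    v ⬝ᵥ (obsGram n ψ T *ᵥ v) = ∫ τ in (0:ℝ)..T, (ψ τ ⬝ᵥ v) ^ 2 := by
  simp only [dotProduct, obsGram_mulVec_apply hψ, ← intervalIntegral.integral_const_mul]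
  rw [← intervalIntegral.integral_finsetSum
    fun j _ => Continuous.intervalIntegrable (by fun_prop) _ _]
  refine intervalIntegral.integral_congr fun τ _ => ?_
  simp only [sq, ← mul_assoc, ← Finset.sum_mul]
  simp only [mul_comm]

theorem obsGram_mulVec_eq_zero_iff {n : ℕ} {ψ : ℝ → Fin n → ℝ} (hψ : Continuous ψ) {T : ℝ}
    (hT : 0 < T) (v : Fin n → ℝ) :
    obsGram n ψ T *ᵥ v = 0 ↔ ∀ t ∈ Set.Icc 0 T, ψ t ⬝ᵥ v = 0 := by
  constructor
  · intro h
    by_contra! ⟨t, ht, hne⟩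
    have hc : Continuous fun τ => (ψ τ ⬝ᵥ v) ^ 2 := by fun_prop
    have hpos := intervalIntegral.integral_pos hT hc.continuousOn
      (fun τ _ => sq_nonneg _) ⟨t, ht, by positivity⟩
    rw [← dotProduct_obsGram_mulVec hψ, h, dotProduct_zero] at hpos
    exact hpos.false
  · intro h
    ext i
    rw [obsGram_mulVec_apply hψ, Pi.zero_apply]
    refine intervalIntegral.integral_zero_ae (Filter.Eventually.of_forall fun τ hτ => ?_)
    rw [Set.uIoc_of_le hT.le] at hτ
    rw [h τ (Set.Ioc_subset_Icc_self hτ), mul_zero]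

theorem exists_linearIndependent_fin_of_forall_dotProduct_eq_zero {K : Type*} [Field K] {n : ℕ}
    {s : Set (Fin n → K)} (hs : ∀ v, (∀ w ∈ s, w ⬝ᵥ v = 0) → v = 0) :
    ∃ f : Fin n → Fin n → K, (∀ i, f i ∈ s) ∧ LinearIndependent K f := by
  have hspan : Submodule.span K s = ⊤ := by
    by_contra hne
    obtain ⟨φ, hφ, hle⟩ := Submodule.exists_le_ker_of_lt_top _ (lt_top_iff_ne_top.2 hne)
    have hφv : ∀ w, φ w = w ⬝ᵥ fun i => φ fun j => if i = j then 1 else 0 := fun w =>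
      φ.pi_apply_eq_sum_univ w
    have hv := hs _ fun w hw => (hφv w).symm.trans (hle (Submodule.subset_span hw))
    refine hφ (LinearMap.ext fun w => ?_)
    rw [hφv, hv, dotProduct_zero, LinearMap.zero_apply]
  have hrank : Module.finrank K (Submodule.span K s) = n := by
    rw [hspan, finrank_top, Module.finrank_fin_fun]
  obtain ⟨f, hfs, -, hf⟩ := Submodule.exists_fun_fin_finrank_span_eq K s
  exact ⟨f ∘ Fin.cast hrank.symm, fun i => hfs _, hf.comp _ (Fin.cast_injective _)⟩

/-- Observability (full-rank Gramian over some interval `[0,T]`) is equivalent to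
identifiability (existence of sample times making the sample matrix full rank). -/
theorem observability_iff_identifiability (n : ℕ) (hn : 1 ≤ n)
    (C : ℝ → Fin n → ℝ) (hC : Continuous C)
    (Φ : ℝ → Matrix (Fin n) (Fin n) ℝ) (hΦ : Continuous Φ) (hΦ0 : Φ 0 = 1)
    (ψ : ℝ → Fin n → ℝ) (hψ : ∀ t, ψ t = (Φ t)ᵀ *ᵥ C t) :
    (∃ T > (0:ℝ), (obsGram n ψ T).rank = n) ↔
    (∃ t : Fin n → ℝ, (∀ i, 0 ≤ t i) ∧ (sampleMatrix n ψ t).rank = n) := by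
  have hcont : Continuous ψ := by
    rw [funext hψ]
    fun_prop
  constructor
  · rintro ⟨T, hT, hrank⟩
    rw [Matrix.rank_eq_iff_forall_mulVec_eq_zero] at hrank
    obtain ⟨f, hfs, hf⟩ :=
      exists_linearIndependent_fin_of_forall_dotProduct_eq_zero (s := ψ '' Set.Ici 0) fun v hv =>
        hrank v <| (obsGram_mulVec_eq_zero_iff hcont hT v).2 fun t ht =>
          hv _ (Set.mem_image_of_mem ψ ht.1)
    choose t ht htf using hfs
    refine ⟨t, ht, ?_⟩
    have hsample : sampleMatrix n ψ t = (Matrix.of f)ᵀ := by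
      ext i j
      simp [sampleMatrix, htf]
    rw [hsample, Matrix.rank_transpose, LinearIndependent.rank_matrix (M := Matrix.of f) hf,
      Fintype.card_fin]
  · rintro ⟨t, ht, hrank⟩
    rw [← Matrix.rank_transpose, Matrix.rank_eq_iff_forall_mulVec_eq_zero] at hrank
    have hT : 0 < 1 + ∑ i, t i := by
      have := Finset.sum_nonneg fun i (_ : i ∈ Finset.univ) => ht i
      linarith
    refine ⟨1 + ∑ i, t i, hT, ?_⟩
    rw [Matrix.rank_eq_iff_forall_mulVec_eq_zero]
    intro v hv
    rw [obsGram_mulVec_eq_zero_iff hcont hT] at hv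
    refine hrank v (funext fun i => hv (t i) ⟨ht i, ?_⟩)
    have := Finset.single_le_sum (fun j _ => ht j) (Finset.mem_univ i)
    linarith
end

section
/- Let ψ : ℝ → ℝⁿ be continuous. If ψ is interval exciting — there exist t_d > 0 and C_d > 0 with ∫₀^{t_d} ψ(s)ψ(s)ᵀ ds ≥ C_d Iₙ in the sense of quadratic forms — then ψ is identifiable: there exist time instants t₁, …, tₙ ∈ [0, t_d] such that the matrix with columns ψ(t₁), …, ψ(tₙ) has rank n. -/
open Matrix

/-- A vector orthogonal to `ψ` on `[0, T]` lies in the kernel of the observability Gramian. -/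
theorem obsGram_mulVec_eq_zero {n : ℕ} {ψ : ℝ → Fin n → ℝ} (hψ : Continuous ψ) {T : ℝ}
    (hT : 0 ≤ T) {v : Fin n → ℝ} (hv : ∀ τ ∈ Set.Icc 0 T, ψ τ ⬝ᵥ v = 0) :
    obsGram n ψ T *ᵥ v = 0 := by
  ext i
  have hint : ∀ j ∈ Finset.univ, IntervalIntegrable (fun τ => ψ τ i * ψ τ j * v j)
      MeasureTheory.volume 0 T := fun j _ =>
    Continuous.intervalIntegrable (by fun_prop) _ _
  simp only [obsGram, mulVec, dotProduct, of_apply, Pi.zero_apply,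
    ← intervalIntegral.integral_mul_const]
  rw [← intervalIntegral.integral_finsetSum hint]
  refine intervalIntegral.integral_zero_ae (.of_forall fun τ hτ => ?_)
  rw [Set.uIoc_of_le hT] at hτ
  have h := hv τ (Set.Ioc_subset_Icc_self hτ)
  simp only [mul_assoc, ← Finset.mul_sum]
  rw [dotProduct] at h
  rw [h, mul_zero]

/-- A proper subspace of `Fin n → ℝ` is orthogonal to some nonzero vector. -/
theorem Submodule.exists_ne_zero_forall_mem_dotProduct_eq_zero {n : ℕ}
    {p : Submodule ℝ (Fin n → ℝ)} (hp : p ≠ ⊤) :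
    ∃ v : Fin n → ℝ, v ≠ 0 ∧ ∀ x ∈ p, x ⬝ᵥ v = 0 := by
  obtain ⟨f, hf, hpf⟩ := p.exists_le_ker_of_lt_top hp.lt_top
  obtain ⟨v, rfl⟩ := (dotProductEquiv ℝ (Fin n)).surjective f
  refine ⟨v, fun h => hf (by simp [h]), fun x hx => ?_⟩
  simpa [dotProduct_comm] using hpf hx

/-- Interval excitation implies identifiability: if `∫₀^{t_d} ψψᵀ ≥ C_d Iₙ` as
quadratic forms for some `t_d, C_d > 0`, then there are sample times in `[0, t_d]`
making the sample matrix full rank. -/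
theorem interval_excitation_implies_identifiability (n : ℕ) (hn : 1 ≤ n)
    (ψ : ℝ → Fin n → ℝ) (hψ : Continuous ψ)
    (td Cd : ℝ) (htd : 0 < td) (hCd : 0 < Cd)
    (hIE : ∀ v : Fin n → ℝ, Cd * (v ⬝ᵥ v) ≤ v ⬝ᵥ (obsGram n ψ td *ᵥ v)) :
    ∃ t : Fin n → ℝ, (∀ i, t i ∈ Set.Icc (0:ℝ) td) ∧
      (sampleMatrix n ψ t).rank = n := by
  have hspan : Submodule.span ℝ (ψ '' Set.Icc 0 td) = ⊤ := by
    by_contra h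
    obtain ⟨v, hv0, hv⟩ := Submodule.exists_ne_zero_forall_mem_dotProduct_eq_zero h
    have hW := obsGram_mulVec_eq_zero hψ htd.le fun τ hτ =>
      hv _ (Submodule.subset_span (Set.mem_image_of_mem ψ hτ))
    have hle := hIE v
    rw [hW, dotProduct_zero] at hle
    have hpos : 0 < v ⬝ᵥ v :=
      (Finset.sum_nonneg fun i _ => mul_self_nonneg (v i)).lt_of_ne'
        (dotProduct_self_eq_zero.not.mpr hv0)
    exact absurd hle (mul_pos hCd hpos).not_ge
  have hrank : Module.finrank ℝ (Submodule.span ℝ (ψ '' Set.Icc 0 td)) = n := by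
    rw [hspan, finrank_top, Module.finrank_fin_fun]
  have hf := Submodule.exists_fun_fin_finrank_span_eq ℝ (ψ '' Set.Icc 0 td)
  rw [hrank] at hf
  obtain ⟨f, hfmem, hfspan, -⟩ := hf
  choose t ht hft using hfmem
  refine ⟨t, ht, ?_⟩
  have hcol : (sampleMatrix n ψ t).col = f := funext hft
  rw [rank_eq_finrank_span_cols, hcol, hfspan, hrank]
end

section
/- With the gradient estimator θ̂_g and fundamental matrix Ω of the previous setting, define D(t) := Iₙ − Ω(t), Δ(t) := det D(t), and Y(t) := adj(D(t)) (θ̂_g(t) − Ω(t)θ_{g0}), where adj denotes the adjugate matrix. Then the scalar linear regression equation Y(t) = Δ(t)·θ holds for all t ≥ 0, i.e. each component satisfies Yᵢ(t) = Δ(t)θᵢ. -/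
open Matrix

section

variable {ι : Type*} [Fintype ι]

theorem HasDerivAt.dotProduct {u v : ℝ → ι → ℝ} {u' v' : ι → ℝ} {t : ℝ}
    (hu : HasDerivAt u u' t) (hv : HasDerivAt v v' t) :
    HasDerivAt (fun s => u s ⬝ᵥ v s) (u' ⬝ᵥ v t + u t ⬝ᵥ v') t := by
  simp only [_root_.dotProduct, ← Finset.sum_add_distrib]
  exact HasDerivAt.fun_sum fun i _ => (hasDerivAt_pi.1 hu i).mul (hasDerivAt_pi.1 hv i)

theorem HasDerivAt.mulVec_const {A : ℝ → Matrix ι ι ℝ} {A' : Matrix ι ι ℝ} {t : ℝ}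
    (hA : ∀ i j, HasDerivAt (fun s => A s i j) (A' i j) t) (x : ι → ℝ) :
    HasDerivAt (fun s => A s *ᵥ x) (A' *ᵥ x) t :=
  hasDerivAt_pi.2 fun i => HasDerivAt.fun_sum fun j _ => (hA i j).mul_const (x j)

/-- The squared Euclidean norm is nonincreasing along the gradient error flow
`w' = -γ (ψ ⬝ᵥ w) ψ`, so a solution starting at zero stays at zero. -/
theorem eq_zero_of_gradient_error_flow {γ : ℝ} (hγ : 0 ≤ γ) {ψ w : ℝ → ι → ℝ}
    (hw : ∀ t, HasDerivAt w ((-γ * (ψ t ⬝ᵥ w t)) • ψ t) t) (hw0 : w 0 = 0)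
    {t : ℝ} (ht : 0 ≤ t) : w t = 0 := by
  have hderiv (s : ℝ) := (hw s).dotProduct (hw s)
  have hanti : Antitone fun s => w s ⬝ᵥ w s := by
    refine antitone_of_deriv_nonpos (fun s => (hderiv s).differentiableAt) fun s => ?_
    rw [(hderiv s).deriv, smul_dotProduct, dotProduct_smul, dotProduct_comm (w s) (ψ s),
      smul_eq_mul]
    nlinarith [mul_nonneg hγ (sq_nonneg (ψ s ⬝ᵥ w s))]
  have hle : w t ⬝ᵥ w t ≤ 0 := by simpa [hw0] using hanti ht
  exact dotProduct_self_eq_zero.1 (hle.antisymm (Finset.sum_nonneg fun i _ => mul_self_nonneg _))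

end

/-- DREM scalar regression: with `D(t) := Iₙ − Ω(t)`, `Δ(t) := det D(t)` and
`Y(t) := adj(D(t))(θ̂_g(t) − Ω(t)θ_{g0})`, one has `Y(t) = Δ(t)·θ` for all `t ≥ 0`. -/
theorem drem_scalar_regression (n : ℕ) (hn : 1 ≤ n)
    (γg : ℝ) (hγg : 0 < γg)
    (θ θg0 : Fin n → ℝ)
    (ψ : ℝ → Fin n → ℝ) (hψ : Continuous ψ)
    (calY : ℝ → ℝ) (hcalY : ∀ t, calY t = ψ t ⬝ᵥ θ)
    (θg : ℝ → Fin n → ℝ)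
    (hθg : ∀ t, HasDerivAt θg ((γg * (calY t - ψ t ⬝ᵥ θg t)) • ψ t) t)
    (hθg0 : θg 0 = θg0)
    (Ω : ℝ → Matrix (Fin n) (Fin n) ℝ)
    (hΩ : ∀ t, ∀ i j, HasDerivAt (fun s => Ω s i j)
        ((((-γg) • vecMulVec (ψ t) (ψ t)) * Ω t) i j) t)
    (hΩ0 : Ω 0 = 1)
    (D : ℝ → Matrix (Fin n) (Fin n) ℝ) (hD : ∀ t, D t = 1 - Ω t)
    (Δ : ℝ → ℝ) (hΔ : ∀ t, Δ t = (D t).det)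
    (Y : ℝ → Fin n → ℝ)
    (hYdef : ∀ t, Y t = (D t).adjugate *ᵥ (θg t - Ω t *ᵥ θg0)) :
    ∀ t ≥ (0:ℝ), Y t = Δ t • θ := by
  intro t ht
  have herr (s : ℝ) : HasDerivAt (fun s => θg s - θ - Ω s *ᵥ (θg0 - θ))
      ((-γg * (ψ s ⬝ᵥ (θg s - θ - Ω s *ᵥ (θg0 - θ)))) • ψ s) s := by
    refine (((hθg s).sub_const θ).sub
      (HasDerivAt.mulVec_const (hΩ s) (θg0 - θ))).congr_deriv ?_
    rw [← mulVec_mulVec, smul_mulVec, vecMulVec_mulVec, hcalY]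
    ext i
    simp only [Pi.sub_apply, Pi.smul_apply, smul_eq_mul, MulOpposite.smul_eq_mul_unop,
      MulOpposite.unop_op, dotProduct_sub]
    ring
  have hzero : θg t - θ - Ω t *ᵥ (θg0 - θ) = 0 :=
    eq_zero_of_gradient_error_flow hγg.le herr (by simp [hθg0, hΩ0]) ht
  have hreg : θg t - Ω t *ᵥ θg0 = D t *ᵥ θ := by
    rw [hD, sub_mulVec, one_mulVec, ← sub_eq_zero, ← hzero, mulVec_sub]
    abel
  rw [hYdef, hreg, mulVec_mulVec, adjugate_mul, smul_mulVec, one_mulVec, hΔ]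
end

section
/- Let Ω : ℝ → Matrix (Fin n) (Fin n) ℝ satisfy Ω'(t) = −γ ψ(t)ψ(t)ᵀ Ω(t) with Ω(0) = Iₙ, where γ > 0 and ψ is continuous. Then for every v ∈ ℝⁿ the map t ↦ |Ω(t)v| is nonincreasing on [0,∞); in particular |Ω(t)v| ≤ |v| for all t ≥ 0 and all v, so the operator norm of Ω(t) is at most 1 for all t ≥ 0. -/
open Matrix

/-- Entrywise differentiable matrix curves act on a fixed vector differentiably. -/
theorem hasDerivAt_mulVec_apply {m n : Type*} [Fintype n] {A : ℝ → Matrix m n ℝ}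
    {A' : Matrix m n ℝ} {t : ℝ} (hA : ∀ i j, HasDerivAt (fun s => A s i j) (A' i j) t)
    (v : n → ℝ) (i : m) : HasDerivAt (fun s => (A s *ᵥ v) i) ((A' *ᵥ v) i) t := by
  simp only [mulVec, dotProduct]
  exact HasDerivAt.fun_sum fun j _ => (hA i j).mul_const (v j)

/-- The derivative of the squared Euclidean norm of a coordinatewise differentiable curve. -/
theorem hasDerivAt_dotProduct_self {n : Type*} [Fintype n] {x : ℝ → n → ℝ} {x' : n → ℝ} {t : ℝ}
    (hx : ∀ i, HasDerivAt (fun s => x s i) (x' i) t) :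
    HasDerivAt (fun s => x s ⬝ᵥ x s) (2 * (x t ⬝ᵥ x')) t := by
  have h : HasDerivAt (fun s => x s ⬝ᵥ x s) (∑ i, (x' i * x t i + x t i * x' i)) t :=
    HasDerivAt.fun_sum fun i _ => (hx i).mul (hx i)
  convert h using 1
  simp only [dotProduct, Finset.mul_sum]
  exact Finset.sum_congr rfl fun i _ => by ring

/-- A rank-one update `-γ u uᵀ` with `γ ≥ 0` is dissipative. -/
theorem dotProduct_neg_smul_vecMulVec_mulVec_nonpos {n : Type*} [Fintype n] {γ : ℝ} (hγ : 0 ≤ γ)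
    (u x : n → ℝ) : x ⬝ᵥ (((-γ) • vecMulVec u u) *ᵥ x) ≤ 0 := by
  have h : x ⬝ᵥ (((-γ) • vecMulVec u u) *ᵥ x) = -(γ * (u ⬝ᵥ x) ^ 2) := by
    rw [smul_mulVec, vecMulVec_mulVec, dotProduct_smul, dotProduct_smul, dotProduct_comm x u]
    simp only [smul_eq_mul, MulOpposite.smul_eq_mul_unop, MulOpposite.unop_op]
    ring
  rw [h]
  exact neg_nonpos.mpr (by positivity)

/-- For `Ω' = −γ ψψᵀ Ω`, `Ω(0) = Iₙ`, the Euclidean norm `|Ω(t)v|` is nonincreasing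
on `[0,∞)` for every `v`; in particular `|Ω(t)v| ≤ |v|` for all `t ≥ 0`, so the
operator norm of `Ω(t)` is at most 1. -/
theorem omega_contraction (n : ℕ) (hn : 1 ≤ n)
    (γ : ℝ) (hγ : 0 < γ)
    (ψ : ℝ → Fin n → ℝ) (hψ : Continuous ψ)
    (Ω : ℝ → Matrix (Fin n) (Fin n) ℝ)
    (hΩ : ∀ t, ∀ i j, HasDerivAt (fun s => Ω s i j)
        ((((-γ) • vecMulVec (ψ t) (ψ t)) * Ω t) i j) t)
    (hΩ0 : Ω 0 = 1) :
    (∀ v : Fin n → ℝ, ∀ s t : ℝ, 0 ≤ s → s ≤ t →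
        Real.sqrt ((Ω t *ᵥ v) ⬝ᵥ (Ω t *ᵥ v)) ≤
          Real.sqrt ((Ω s *ᵥ v) ⬝ᵥ (Ω s *ᵥ v))) ∧
    (∀ v : Fin n → ℝ, ∀ t ≥ (0:ℝ),
        Real.sqrt ((Ω t *ᵥ v) ⬝ᵥ (Ω t *ᵥ v)) ≤ Real.sqrt (v ⬝ᵥ v)) := by
  have hanti (v : Fin n → ℝ) : Antitone fun t => (Ω t *ᵥ v) ⬝ᵥ (Ω t *ᵥ v) := by
    refine antitone_of_hasDerivAt_nonpos
      (fun t => hasDerivAt_dotProduct_self fun i => hasDerivAt_mulVec_apply (hΩ t) v i)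
      fun t => ?_
    rw [← mulVec_mulVec]
    have := dotProduct_neg_smul_vecMulVec_mulVec_nonpos hγ.le (ψ t) (Ω t *ᵥ v)
    simp only [Pi.zero_apply]
    linarith
  refine ⟨fun v s t _ hst => Real.sqrt_le_sqrt (hanti v hst), fun v t ht => ?_⟩
  simpa [hΩ0] using Real.sqrt_le_sqrt (hanti v ht)
end

section
/- (2G+D observer, main result.) Consider x'(t) = A(t)x(t) + b(t), y(t) = C(t)ᵀx(t), with A, b, C continuous, and the 2G+D observer: ξ'(t) = A(t)ξ(t) + b(t); Φ_A'(t) = A(t)Φ_A(t), Φ_A(0) = Iₙ; 𝒴(t) := y(t) − C(t)ᵀξ(t); ψ(t) := Φ_A(t)ᵀC(t); θ̂_g'(t) = γ_g ψ(t)(𝒴(t) − ψ(t)ᵀθ̂_g(t)), θ̂_g(0) = θ_{g0}; Ω'(t) = −γ_g ψ(t)ψ(t)ᵀΩ(t), Ω(0) = Iₙ; Δ(t) := det(Iₙ − Ω(t)); Y(t) := adj(Iₙ − Ω(t))(θ̂_g(t) − Ω(t)θ_{g0}); θ̂'(t) = γΔ(t)(Y(t) − Δ(t)θ̂(t)); and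 x̂(t) := ξ(t) + Φ_A(t)θ̂(t). Assume the operator norm of Φ_A(t) is bounded by c₁ for all t ≥ 0, and that the pair is observable: there exists T > 0 such that W(0,T) := ∫₀ᵀ ψ(τ)ψ(τ)ᵀ dτ has rank n. Then for all initial conditions x(0), ξ(0) ∈ ℝⁿ, θ_{g0}, θ̂(0) ∈ ℝⁿ there exist c > 0 and λ > 0 such that |x̂(t) − x(t)| ≤ c e^{−λ t} for all t ≥ 0. -/
open Matrix

/-- The zero solution is the unique forward solution of a linear ODE with zero initial value. -/
theorem linearODE_eq_zero {n : ℕ} {M : ℝ → Matrix (Fin n) (Fin n) ℝ} (hM : Continuous M)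
    {e : ℝ → Fin n → ℝ} (he : ∀ t ≥ (0 : ℝ), HasDerivAt e (M t *ᵥ e t) t) (he0 : e 0 = 0) :
    ∀ t ≥ (0 : ℝ), e t = 0 := by
  intro t ht
  have hcont : Continuous fun s => ∑ i, ∑ j, |M s i j| :=
    continuous_finsetSum _ fun i _ => continuous_finsetSum _ fun j _ =>
      (hM.matrix_elem i j).abs
  obtain ⟨K, hK⟩ := (isCompact_Icc (a := 0) (b := t)).bddAbove_image hcont.continuousOn
  have hbound : ∀ s ∈ Set.Ico 0 t, ‖M s *ᵥ e s‖ ≤ K * ‖e s‖ + 0 := by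
    intro s hs
    have hKs : ∑ i, ∑ j, |M s i j| ≤ K := hK ⟨s, ⟨hs.1, hs.2.le⟩, rfl⟩
    rw [add_zero]
    refine le_trans ?_ (mul_le_mul_of_nonneg_right hKs (norm_nonneg _))
    refine (pi_norm_le_iff_of_nonneg (by positivity)).2 fun i => ?_
    calc ‖(M s *ᵥ e s) i‖ ≤ ∑ j, ‖M s i j * e s j‖ := by
          simpa only [mulVec, dotProduct] using
            norm_sum_le Finset.univ fun j => M s i j * e s j
      _ ≤ ∑ j, |M s i j| * ‖e s‖ := by
          refine Finset.sum_le_sum fun j _ => ?_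
          rw [norm_mul]
          exact mul_le_mul_of_nonneg_left (norm_le_pi_norm _ j) (norm_nonneg _)
      _ = (∑ j, |M s i j|) * ‖e s‖ := by rw [Finset.sum_mul]
      _ ≤ _ := by
          refine mul_le_mul_of_nonneg_right ?_ (norm_nonneg _)
          exact Finset.single_le_sum (f := fun i => ∑ j, |M s i j|)
            (fun i _ => by positivity) (Finset.mem_univ i)
  have h := norm_le_gronwallBound_of_norm_deriv_right_le (f := e) (f' := fun s => M s *ᵥ e s)
    (δ := 0) (K := K) (ε := 0) (a := 0) (b := t)
    (fun s hs => (he s hs.1).continuousAt.continuousWithinAt)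
    (fun s hs => (he s hs.1).hasDerivWithinAt) (by simp [he0]) hbound t ⟨ht, le_rfl⟩
  simpa [gronwallBound_ε0_δ0] using h

theorem hasDerivAt_mulVec_const {n : ℕ} {F : ℝ → Matrix (Fin n) (Fin n) ℝ}
    {F' : Matrix (Fin n) (Fin n) ℝ} {t : ℝ}
    (hF : ∀ i j, HasDerivAt (fun s => F s i j) (F' i j) t) (v : Fin n → ℝ) :
    HasDerivAt (fun s => F s *ᵥ v) (F' *ᵥ v) t :=
  hasDerivAt_pi.2 fun i => by
    simpa only [mulVec, dotProduct] using
      HasDerivAt.fun_sum (u := Finset.univ) fun j _ => (hF i j).mul_const (v j)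

theorem hasDerivAt_dotProduct_self_s14 {n : ℕ} {f : ℝ → Fin n → ℝ} {f' : Fin n → ℝ} {t : ℝ}
    (hf : HasDerivAt f f' t) :
    HasDerivAt (fun s => f s ⬝ᵥ f s) (2 * (f t ⬝ᵥ f')) t := by
  have h := HasDerivAt.fun_sum (u := Finset.univ) fun i _ =>
    (hasDerivAt_pi.1 hf i).fun_mul (hasDerivAt_pi.1 hf i)
  refine h.congr_deriv ?_
  simp only [dotProduct, Finset.mul_sum]
  exact Finset.sum_congr rfl fun i _ => by ring

/-- A full-rank Gramian excludes nonzero directions orthogonal to the signal on `(0, T)`. -/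
theorem eq_zero_of_rank_obsGram {n : ℕ} {ψ : ℝ → Fin n → ℝ} (hψ : Continuous ψ) {T : ℝ}
    (hT : 0 < T) (hrank : (obsGram n ψ T).rank = n) {v : Fin n → ℝ}
    (hv : ∀ t ∈ Set.Ioo 0 T, ψ t ⬝ᵥ v = 0) : v = 0 := by
  have hzero : obsGram n ψ T *ᵥ v = 0 := by
    funext i
    have hi : ∀ j, Continuous fun t => ψ t j := fun j => (continuous_apply j).comp hψ
    calc (obsGram n ψ T *ᵥ v) i = ∑ j, ∫ t in (0 : ℝ)..T, ψ t i * ψ t j * v j := by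
          simp [obsGram, mulVec, dotProduct]
      _ = ∫ t in (0 : ℝ)..T, ∑ j, ψ t i * ψ t j * v j := by
          rw [intervalIntegral.integral_finsetSum]
          exact fun j _ => (((hi i).mul (hi j)).mul_const (v j)).intervalIntegrable _ _
      _ = ∫ t in (0 : ℝ)..T, (0 : ℝ) := by
          refine intervalIntegral.integral_congr_Ioo_of_le hT.le fun t ht => ?_
          have : ∑ j, ψ t i * ψ t j * v j = ψ t i * (ψ t ⬝ᵥ v) := by
            simp [dotProduct, Finset.mul_sum, mul_assoc]
          simp [this, hv t ht]
      _ = 0 := by simp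
  have hker : Function.Injective (obsGram n ψ T).mulVec := by
    have hrange : LinearMap.range (obsGram n ψ T).mulVecLin = ⊤ :=
      Submodule.eq_top_of_finrank_eq (by simpa [Matrix.rank] using hrank)
    exact LinearMap.injective_iff_surjective.2 (LinearMap.range_eq_top.1 hrange)
  exact hker (by simpa using hzero)

/-- Matrices dominated by a strict contraction `N` have `det (1 - M)` bounded away from zero. -/
theorem exists_pos_le_abs_det_one_sub {n : ℕ} {N : Matrix (Fin n) (Fin n) ℝ}
    (hN : ∀ v ≠ 0, (N *ᵥ v) ⬝ᵥ (N *ᵥ v) < v ⬝ᵥ v) :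
    ∃ δ > (0 : ℝ), ∀ M : Matrix (Fin n) (Fin n) ℝ,
      (∀ v, (M *ᵥ v) ⬝ᵥ (M *ᵥ v) ≤ (N *ᵥ v) ⬝ᵥ (N *ᵥ v)) → δ ≤ |(1 - M).det| := by
  let S : Set (Matrix (Fin n) (Fin n) ℝ) :=
    {M | ∀ v, (M *ᵥ v) ⬝ᵥ (M *ᵥ v) ≤ (N *ᵥ v) ⬝ᵥ (N *ᵥ v)}
  have hclosed : IsClosed S := by
    simp only [S, Set.ofPred_forall]
    refine isClosed_iInter fun v => isClosed_le ?_ continuous_const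
    fun_prop
  have hentry : ∀ (M : Matrix (Fin n) (Fin n) ℝ) i j,
      M i j ^ 2 ≤ (M *ᵥ Pi.single j 1) ⬝ᵥ (M *ᵥ Pi.single j 1) := by
    intro M i j
    rw [mulVec_single_one, sq]
    exact Finset.single_le_sum (f := fun i => M i j * M i j)
      (fun i _ => mul_self_nonneg _) (Finset.mem_univ i)
  have hcompact : IsCompact S := by
    refine IsCompact.of_isClosed_subset (isCompact_univ_pi fun i => isCompact_univ_pi fun j =>
      isCompact_Icc (a := -√((N *ᵥ Pi.single j 1) ⬝ᵥ (N *ᵥ Pi.single j 1)))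
        (b := √((N *ᵥ Pi.single j 1) ⬝ᵥ (N *ᵥ Pi.single j 1)))) hclosed ?_
    intro M hM i _ j _
    exact abs_le.1 (Real.abs_le_sqrt ((hentry M i j).trans (hM _)))
  have hdet : Continuous fun M : Matrix (Fin n) (Fin n) ℝ => |(1 - M).det| := by fun_prop
  obtain ⟨M₀, hM₀, hmin⟩ := hcompact.exists_isMinOn ⟨N, fun _ => le_rfl⟩ hdet.continuousOn
  refine ⟨|(1 - M₀).det|, abs_pos.2 fun h => ?_, fun M hM => hmin hM⟩
  obtain ⟨v, hv, hv0⟩ := exists_mulVec_eq_zero_iff.2 h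
  rw [sub_mulVec, one_mulVec, sub_eq_zero] at hv0
  have h1 := hM₀ v
  rw [← hv0] at h1
  exact (hN v hv).not_ge h1

/-- A nonnegative-rate scalar decay whose rate is at least `μ` after time `T`. -/
theorem le_exp_decay {V r : ℝ → ℝ} {μ T : ℝ} (hT : 0 ≤ T) (hμ : 0 ≤ μ)
    (hV : ∀ t ≥ (0 : ℝ), HasDerivAt V (-r t * V t) t) (hV0 : ∀ t, 0 ≤ V t)
    (hr : ∀ t ≥ (0 : ℝ), 0 ≤ r t) (hrT : ∀ t ≥ T, μ ≤ r t) :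
    ∀ t ≥ (0 : ℝ), V t ≤ V 0 * Real.exp (μ * T) * Real.exp (-μ * t) := by
  have hanti : AntitoneOn V (Set.Ici 0) := by
    refine antitoneOn_of_hasDerivWithinAt_nonpos (convex_Ici 0)
      (fun t ht => (hV t ht).continuousAt.continuousWithinAt)
      (fun t ht => (hV t (interior_subset ht)).hasDerivWithinAt) fun t ht => ?_
    have := mul_nonneg (hr t (interior_subset ht)) (hV0 t)
    linarith
  have hanti' : AntitoneOn (fun t => V t * Real.exp (μ * t)) (Set.Ici T) := by
    have hd : ∀ t ≥ T, HasDerivAt (fun t => V t * Real.exp (μ * t))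
        ((μ - r t) * (V t * Real.exp (μ * t))) t := fun t ht =>
      ((hV t (hT.trans ht)).fun_mul ((hasDerivAt_id t).const_mul μ).exp).congr_deriv (by
        simp only [id]; ring)
    refine antitoneOn_of_hasDerivWithinAt_nonpos (convex_Ici T)
      (fun t ht => (hd t ht).continuousAt.continuousWithinAt)
      (fun t ht => (hd t (interior_subset ht)).hasDerivWithinAt) fun t ht => ?_
    exact mul_nonpos_of_nonpos_of_nonneg (sub_nonpos.2 (hrT t (interior_subset ht)))
      (mul_nonneg (hV0 t) (Real.exp_pos _).le)
  intro t ht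
  rw [mul_assoc, ← Real.exp_add]
  rcases le_total t T with htT | htT
  · refine (hanti Set.self_mem_Ici ht ht).trans (le_mul_of_one_le_right (hV0 0) ?_)
    exact Real.one_le_exp (by nlinarith)
  · have h1 := hanti' Set.self_mem_Ici htT htT
    have h2 : V T ≤ V 0 := hanti Set.self_mem_Ici hT hT
    calc V t = V t * Real.exp (μ * t) * Real.exp (-μ * t) := by
          rw [mul_assoc, ← Real.exp_add]; simp
      _ ≤ V T * Real.exp (μ * T) * Real.exp (-μ * t) := by gcongr
      _ ≤ V 0 * Real.exp (μ * T) * Real.exp (-μ * t) := by gcongr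
      _ = _ := by rw [mul_assoc, ← Real.exp_add]

/-- The gradient flow `Ω' = -γ ψ ψᵀ Ω`, `Ω 0 = 1`, is contractive, and strictly so at time `T`
when the Gramian of `ψ` on `[0, T]` has full rank. -/
theorem gradientFlow_contraction {n : ℕ} {γ : ℝ} (hγ : 0 < γ) {ψ : ℝ → Fin n → ℝ}
    (hψ : Continuous ψ) {Ω : ℝ → Matrix (Fin n) (Fin n) ℝ}
    (hΩ : ∀ t, ∀ i j, HasDerivAt (fun s => Ω s i j)
      ((((-γ) • vecMulVec (ψ t) (ψ t)) * Ω t) i j) t) (hΩ0 : Ω 0 = 1)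
    {T : ℝ} (hT : 0 < T) (hrank : (obsGram n ψ T).rank = n) :
    (∀ v, Antitone fun t => (Ω t *ᵥ v) ⬝ᵥ (Ω t *ᵥ v)) ∧
      ∀ v ≠ 0, (Ω T *ᵥ v) ⬝ᵥ (Ω T *ᵥ v) < v ⬝ᵥ v := by
  have hvec : ∀ v t, HasDerivAt (fun s => Ω s *ᵥ v)
      ((-γ * (ψ t ⬝ᵥ (Ω t *ᵥ v))) • ψ t) t := fun v t =>
    (hasDerivAt_mulVec_const (hΩ t) v).congr_deriv (by
      rw [← mulVec_mulVec, smul_mulVec, vecMulVec_mulVec, mul_smul]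
      simp)
  have hsq : ∀ v t, HasDerivAt (fun s => (Ω s *ᵥ v) ⬝ᵥ (Ω s *ᵥ v))
      (-(2 * γ * (ψ t ⬝ᵥ (Ω t *ᵥ v)) ^ 2)) t := fun v t =>
    (hasDerivAt_dotProduct_self_s14 (hvec v t)).congr_deriv (by
      rw [dotProduct_smul, dotProduct_comm (Ω t *ᵥ v), smul_eq_mul]; ring)
  have hanti : ∀ v, Antitone fun t => (Ω t *ᵥ v) ⬝ᵥ (Ω t *ᵥ v) := fun v =>
    antitone_of_hasDerivAt_nonpos (hsq v) fun t => neg_nonpos.2 (by positivity)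
  refine ⟨hanti, fun v hv => ?_⟩
  have hle : (Ω T *ᵥ v) ⬝ᵥ (Ω T *ᵥ v) ≤ v ⬝ᵥ v := by
    simpa [hΩ0] using hanti v hT.le
  refine lt_of_le_of_ne hle fun heq => hv ?_
  have hconst : ∀ t ∈ Set.Icc 0 T, (Ω t *ᵥ v) ⬝ᵥ (Ω t *ᵥ v) = v ⬝ᵥ v := fun t ht =>
    le_antisymm (by simpa [hΩ0] using hanti v ht.1) (heq ▸ hanti v ht.2)
  have horth : ∀ t ∈ Set.Ioo 0 T, ψ t ⬝ᵥ (Ω t *ᵥ v) = 0 := by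
    intro t ht
    have hev : (fun s => (Ω s *ᵥ v) ⬝ᵥ (Ω s *ᵥ v)) =ᶠ[nhds t] fun _ => v ⬝ᵥ v := by
      filter_upwards [Icc_mem_nhds ht.1 ht.2] with s hs using hconst s hs
    have h := (hsq v t).unique ((hasDerivAt_const t _).congr_of_eventuallyEq hev)
    have : (ψ t ⬝ᵥ (Ω t *ᵥ v)) ^ 2 = 0 := by
      have h2 : 2 * γ * (ψ t ⬝ᵥ (Ω t *ᵥ v)) ^ 2 = 0 := by linarith
      exact (mul_eq_zero.1 h2).resolve_left (by positivity)
    exact pow_eq_zero_iff two_ne_zero |>.1 this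
  have horth' : ∀ t ∈ Set.Icc 0 T, ψ t ⬝ᵥ (Ω t *ᵥ v) = 0 := by
    have hc : Continuous fun t => ψ t ⬝ᵥ (Ω t *ᵥ v) :=
      hψ.dotProduct (continuous_iff_continuousAt.2 fun t => (hvec v t).continuousAt)
    have h := Set.EqOn.closure (s := Set.Ioo 0 T) horth hc continuous_const
    rwa [closure_Ioo hT.ne] at h
  have hfix : ∀ t ∈ Set.Icc 0 T, Ω t *ᵥ v = v := by
    intro t ht
    have h := constant_of_has_deriv_right_zero (f := fun s => Ω s *ᵥ v) (a := 0) (b := T)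
      (fun s _ => (hvec v s).continuousAt.continuousWithinAt)
      (fun s hs => by
        simpa [horth' s ⟨hs.1, hs.2.le⟩] using (hvec v s).hasDerivWithinAt) t ht
    simpa [hΩ0] using h
  exact eq_zero_of_rank_obsGram hψ hT hrank fun t ht => by
    simpa [hfix t ⟨ht.1.le, ht.2.le⟩] using horth t ht

/-- 2G+D observer, main result: under observability of the pair (full-rank Gramian
over some finite interval) and uniform boundedness of the transition matrix, the
state estimate `x̂ = ξ + Φ_A θ̂` converges to `x` globally exponentially. -/
theorem two_gd_observer_main (n : ℕ) (hn : 1 ≤ n)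
    (γg γ c₁ : ℝ) (hγg : 0 < γg) (hγ : 0 < γ) (hc₁ : 0 < c₁)
    (A : ℝ → Matrix (Fin n) (Fin n) ℝ) (b C : ℝ → Fin n → ℝ)
    (hA : Continuous A) (hb : Continuous b) (hC : Continuous C)
    -- plant
    (x : ℝ → Fin n → ℝ)
    (hx : ∀ t ≥ (0:ℝ), HasDerivAt x (A t *ᵥ x t + b t) t)
    (y : ℝ → ℝ) (hy : ∀ t, y t = C t ⬝ᵥ x t)
    -- GPEBO dynamics
    (ξ : ℝ → Fin n → ℝ)
    (hξ : ∀ t, HasDerivAt ξ (A t *ᵥ ξ t + b t) t)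
    (Φ : ℝ → Matrix (Fin n) (Fin n) ℝ)
    (hΦ : ∀ t, ∀ i j, HasDerivAt (fun s => Φ s i j) ((A t * Φ t) i j) t)
    (hΦ0 : Φ 0 = 1)
    -- measurable signals
    (calY : ℝ → ℝ) (hcalY : ∀ t, calY t = y t - C t ⬝ᵥ ξ t)
    (ψ : ℝ → Fin n → ℝ) (hψ : ∀ t, ψ t = (Φ t)ᵀ *ᵥ C t)
    -- G+D estimator
    (θg0 : Fin n → ℝ)
    (θg : ℝ → Fin n → ℝ)
    (hθg : ∀ t, HasDerivAt θg ((γg * (calY t - ψ t ⬝ᵥ θg t)) • ψ t) t)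
    (hθg0 : θg 0 = θg0)
    (Ω : ℝ → Matrix (Fin n) (Fin n) ℝ)
    (hΩ : ∀ t, ∀ i j, HasDerivAt (fun s => Ω s i j)
        ((((-γg) • vecMulVec (ψ t) (ψ t)) * Ω t) i j) t)
    (hΩ0 : Ω 0 = 1)
    (Δ : ℝ → ℝ) (hΔ : ∀ t, Δ t = ((1 : Matrix (Fin n) (Fin n) ℝ) - Ω t).det)
    (Y : ℝ → Fin n → ℝ)
    (hY : ∀ t, Y t = ((1 : Matrix (Fin n) (Fin n) ℝ) - Ω t).adjugate *ᵥ
        (θg t - Ω t *ᵥ θg0))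
    (θh : ℝ → Fin n → ℝ)
    (hθh : ∀ t, HasDerivAt θh ((γ * Δ t) • (Y t - Δ t • θh t)) t)
    -- state estimate
    (xh : ℝ → Fin n → ℝ) (hxh : ∀ t, xh t = ξ t + Φ t *ᵥ θh t)
    -- boundedness of the transition matrix (operator norm ≤ c₁)
    (hΦbdd : ∀ t ≥ (0:ℝ), ∀ v : Fin n → ℝ,
        Real.sqrt ((Φ t *ᵥ v) ⬝ᵥ (Φ t *ᵥ v)) ≤ c₁ * Real.sqrt (v ⬝ᵥ v))
    -- observability
    (hobs : ∃ T > (0:ℝ), (obsGram n ψ T).rank = n) :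
    ∃ c > (0:ℝ), ∃ lam > (0:ℝ), ∀ t ≥ (0:ℝ),
      Real.sqrt ((xh t - x t) ⬝ᵥ (xh t - x t)) ≤ c * Real.exp (-lam * t) := by
  obtain ⟨T, hT, hrank⟩ := hobs
  have hΦc : Continuous Φ := continuous_matrix fun i j =>
    continuous_iff_continuousAt.2 fun t => (hΦ t i j).continuousAt
  have hψc : Continuous ψ := by
    rw [funext hψ]
    exact hΦc.matrix_transpose.matrix_mulVec hC
  obtain ⟨θ₀, hθ₀⟩ : ∃ θ₀, θ₀ = x 0 - ξ 0 := ⟨_, rfl⟩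
  have hxΦ : ∀ t ≥ (0 : ℝ), x t - ξ t = Φ t *ᵥ θ₀ := by
    intro t ht
    refine sub_eq_zero.1 (linearODE_eq_zero hA (e := fun t => x t - ξ t - Φ t *ᵥ θ₀)
      (fun s hs => ?_) (by simp [hΦ0, hθ₀]) t ht)
    refine (((hx s hs).fun_sub (hξ s)).fun_sub
      (hasDerivAt_mulVec_const (hΦ s) θ₀)).congr_deriv ?_
    rw [mulVec_sub, mulVec_sub, mulVec_mulVec]
    abel
  have hcalYψ : ∀ t ≥ (0 : ℝ), calY t = ψ t ⬝ᵥ θ₀ := by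
    intro t ht
    rw [hcalY, hy, ← dotProduct_sub, hxΦ t ht, hψ, dotProduct_mulVec, mulVec_transpose]
  have hθgΩ : ∀ t ≥ (0 : ℝ), θg t - θ₀ = Ω t *ᵥ (θg0 - θ₀) := by
    intro t ht
    have hM : Continuous fun t => (-γg) • vecMulVec (ψ t) (ψ t) :=
      continuous_const.fun_smul (hψc.matrix_vecMulVec hψc)
    refine sub_eq_zero.1 (linearODE_eq_zero hM
      (e := fun t => θg t - θ₀ - Ω t *ᵥ (θg0 - θ₀))
      (fun s hs => ?_) (by simp [hΩ0, hθg0]) t ht)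
    refine (((hθg s).sub_const θ₀).fun_sub
      (hasDerivAt_mulVec_const (hΩ s) (θg0 - θ₀))).congr_deriv ?_
    rw [← mulVec_mulVec, hcalYψ s hs, smul_mulVec, smul_mulVec, vecMulVec_mulVec,
      vecMulVec_mulVec, dotProduct_sub, dotProduct_sub]
    ext i
    simp only [Pi.sub_apply, Pi.smul_apply, smul_eq_mul, MulOpposite.smul_eq_mul_unop,
      MulOpposite.unop_op]
    ring
  have hYΔ : ∀ t ≥ (0 : ℝ), Y t = Δ t • θ₀ := by
    intro t ht
    have h : θg t - Ω t *ᵥ θg0 = (1 - Ω t) *ᵥ θ₀ := by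
      rw [sub_mulVec, one_mulVec, ← sub_add_cancel (θg t) θ₀, hθgΩ t ht, mulVec_sub]
      abel
    rw [hY, h, mulVec_mulVec, adjugate_mul, smul_mulVec, one_mulVec, hΔ]
  obtain ⟨hanti, hstrict⟩ := gradientFlow_contraction hγg hψc hΩ hΩ0 hT hrank
  obtain ⟨δ, hδ, hδΔ⟩ := exists_pos_le_abs_det_one_sub hstrict
  have hΔT : ∀ t ≥ T, δ ≤ |Δ t| := fun t ht => hΔ t ▸ hδΔ (Ω t) fun v => hanti v ht
  set V : ℝ → ℝ := fun t => (θh t - θ₀) ⬝ᵥ (θh t - θ₀) with hVdef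
  have hV : ∀ t ≥ (0 : ℝ), HasDerivAt V (-(2 * γ * Δ t ^ 2) * V t) t := fun t ht =>
    (hasDerivAt_dotProduct_self_s14 ((hθh t).sub_const θ₀)).congr_deriv (by
      rw [hYΔ t ht, ← smul_sub, smul_smul, dotProduct_smul, ← neg_sub (θh t) θ₀,
        dotProduct_neg, smul_eq_mul]
      ring)
  have hV0 : ∀ t, 0 ≤ V t := fun t => Finset.sum_nonneg fun i _ => mul_self_nonneg _
  have hdecay := le_exp_decay (μ := 2 * γ * δ ^ 2) hT.le (by positivity) hV hV0
    (fun t _ => by positivity) fun t ht => by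
      have h : δ ^ 2 ≤ Δ t ^ 2 := by
        rw [← sq_abs (Δ t)]
        exact pow_le_pow_left₀ hδ.le (hΔT t ht) 2
      gcongr
  set K : ℝ := V 0 * Real.exp (2 * γ * δ ^ 2 * T) with hK
  have hK0 : 0 ≤ K := mul_nonneg (hV0 0) (Real.exp_pos _).le
  refine ⟨c₁ * (√K + 1), by positivity, γ * δ ^ 2, by positivity, fun t ht => ?_⟩
  have herr : xh t - x t = Φ t *ᵥ (θh t - θ₀) := by
    rw [mulVec_sub, ← hxΦ t ht, hxh]
    abel
  have hexp : Real.exp (-(2 * γ * δ ^ 2) * t) = Real.exp (-(γ * δ ^ 2) * t) ^ 2 := by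
    rw [← Real.exp_nat_mul]
    congr 1
    push_cast
    ring
  have hsqrt : √(V t) ≤ √K * Real.exp (-(γ * δ ^ 2) * t) := by
    refine (Real.sqrt_le_sqrt (hdecay t ht)).trans_eq ?_
    rw [hexp, Real.sqrt_mul hK0, Real.sqrt_sq (Real.exp_pos _).le]
  rw [herr]
  calc _ ≤ c₁ * √(V t) := hΦbdd t ht _
    _ ≤ c₁ * (√K * Real.exp (-(γ * δ ^ 2) * t)) := by gcongr
    _ ≤ c₁ * ((√K + 1) * Real.exp (-(γ * δ ^ 2) * t)) := by gcongr; linarith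
    _ = _ := by ring
end

section
/- Let ψ : ℝ → ℝⁿ be continuous and define W(0,T) := ∫₀ᵀ ψ(τ)ψ(τ)ᵀ dτ. Then the following are equivalent: (i) there exists T > 0 such that W(0,T) has rank n; (ii) the set of unobservable initial conditions is trivial, i.e. the only v ∈ ℝⁿ with ψ(t)ᵀv = 0 for all t ≥ 0 is v = 0. -/
open Matrix

theorem rank_eq_iff_mulVec_eq_zero {K : Type*} [Field K] {n : ℕ} (A : Matrix (Fin n) (Fin n) K) :
    A.rank = n ↔ ∀ v, A *ᵥ v = 0 → v = 0 := by
  have h := A.mulVecLin.finrank_range_add_finrank_ker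
  rw [Module.finrank_fin_fun] at h
  have hker : A.rank = n ↔ Module.finrank K (LinearMap.ker A.mulVecLin) = 0 := by
    rw [Matrix.rank]
    lia
  rw [hker, Submodule.finrank_eq_zero, LinearMap.ker_eq_bot']
  rfl

/-- The directions unobservable on `[0,T]`. -/
def unobservableSubmodule {n : ℕ} (ψ : ℝ → Fin n → ℝ) (T : ℝ) : Submodule ℝ (Fin n → ℝ) where
  carrier := {v | ∀ t ∈ Set.Icc 0 T, ψ t ⬝ᵥ v = 0}
  add_mem' hv hw t ht := by rw [dotProduct_add, hv t ht, hw t ht, add_zero]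
  zero_mem' _ _ := dotProduct_zero _
  smul_mem' c v hv t ht := by rw [dotProduct_smul, hv t ht, smul_zero]

theorem unobservableSubmodule_antitone {n : ℕ} (ψ : ℝ → Fin n → ℝ) :
    Antitone (unobservableSubmodule ψ) :=
  fun _ _ hST _ hv t ht => hv t ⟨ht.1, ht.2.trans hST⟩

/-- For some finite `T`, every direction unobservable on `[0,T]` is unobservable for all times. -/
theorem exists_unobservable_forall {n : ℕ} (ψ : ℝ → Fin n → ℝ) :
    ∃ T > (0:ℝ), ∀ v : Fin n → ℝ, (∀ t ∈ Set.Icc 0 T, ψ t ⬝ᵥ v = 0) →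
      ∀ t ≥ (0:ℝ), ψ t ⬝ᵥ v = 0 := by
  obtain ⟨N, hN⟩ := IsArtinian.monotone_stabilizes (R := ℝ) (M := Fin n → ℝ)
    ⟨fun m : ℕ => OrderDual.toDual (unobservableSubmodule ψ m),
      fun _ _ h => unobservableSubmodule_antitone ψ (Nat.cast_le.mpr h)⟩
  refine ⟨N + 1, by positivity, fun v hv t ht => ?_⟩
  have hvN : v ∈ unobservableSubmodule ψ N :=
    unobservableSubmodule_antitone ψ (by simp : (N : ℝ) ≤ N + 1) hv
  obtain ⟨m, hm⟩ := exists_nat_ge t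
  have heq : unobservableSubmodule ψ N = unobservableSubmodule ψ (max N m : ℕ) :=
    hN (max N m) (le_max_left _ _)
  rw [heq] at hvN
  exact hvN t ⟨ht, hm.trans (Nat.cast_le.mpr (le_max_right _ _))⟩

/-- The Gramian attains full rank over some finite interval iff the set of
unobservable directions is trivial: only `v = 0` satisfies `ψ(t)ᵀv = 0` for all
`t ≥ 0`. -/
theorem gramian_rank_iff_no_unobservable_direction (n : ℕ) (hn : 1 ≤ n)
    (ψ : ℝ → Fin n → ℝ) (hψ : Continuous ψ) :
    (∃ T > (0:ℝ), (obsGram n ψ T).rank = n) ↔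
    (∀ v : Fin n → ℝ, (∀ t ≥ (0:ℝ), ψ t ⬝ᵥ v = 0) → v = 0) := by
  simp only [rank_eq_iff_mulVec_eq_zero]
  constructor
  · rintro ⟨T, hT, h⟩ v hv
    exact h v ((obsGram_mulVec_eq_zero_iff hψ hT v).2 fun t ht => hv t ht.1)
  · intro h
    obtain ⟨T, hT, hobs⟩ := exists_unobservable_forall ψ
    exact ⟨T, hT, fun v hv => h v (hobs v ((obsGram_mulVec_eq_zero_iff hψ hT v).1 hv))⟩
end

section
/- (Robustness of the scalar DREM estimator.) Let Δ, d : ℝ → ℝ be continuous with |Δ(t)| ≤ M for all t ≥ 0, |Δ(t)| ≥ δ > 0 for all t ≥ t_d, and |d(t)| ≤ d̄ for all t ≥ 0. Let z : ℝ → ℝ be differentiable with z'(t) = −γ Δ(t)² z(t) + γ Δ(t) d(t) for all t ≥ 0, where γ > 0. Then z is bounded on [0,∞), and limsup_{t→∞} |z(t)| ≤ M d̄ / δ². -/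
/-- One-sided exponential bound for a scalar linear equation `w' = -γ a² w + γ a e` with
`δ ≤ |a| ≤ M` and `|e| ≤ D`, started at time `t₀`. -/
theorem le_add_exp_of_hasDerivAt_linear {γ δ M D t₀ C ε : ℝ} (hγ : 0 < γ) (hδ : 0 < δ)
    (hD : 0 ≤ D) (hC : 0 ≤ C) (hε : 0 < ε) {a e w : ℝ → ℝ}
    (haM : ∀ t ≥ t₀, |a t| ≤ M) (haδ : ∀ t ≥ t₀, δ ≤ |a t|) (he : ∀ t ≥ t₀, |e t| ≤ D)
    (hw : ∀ t ≥ t₀, HasDerivAt w (-γ * a t ^ 2 * w t + γ * a t * e t) t)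
    (hw₀ : w t₀ ≤ C) {t : ℝ} (ht : t₀ ≤ t) :
    w t ≤ M * D / δ ^ 2 + ε + C * Real.exp (-(γ * δ ^ 2) * (t - t₀)) := by
  have hM : 0 < M := hδ.trans_le ((haδ t₀ le_rfl).trans (haM t₀ le_rfl))
  have hβ (s : ℝ) : HasDerivAt
      (fun s => M * D / δ ^ 2 + ε + C * Real.exp (-(γ * δ ^ 2) * (s - t₀)))
      (-(γ * δ ^ 2) * (C * Real.exp (-(γ * δ ^ 2) * (s - t₀)))) s := by
    have h := ((((hasDerivAt_id s).sub_const t₀).const_mul (-(γ * δ ^ 2))).exp.const_mul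
      C).const_add (M * D / δ ^ 2 + ε)
    refine h.congr_deriv ?_
    simp only [id]
    ring
  refine image_le_of_deriv_right_lt_deriv_boundary (a := t₀) (b := t)
    (fun s hs => (hw s hs.1).continuousAt.continuousWithinAt)
    (fun s hs => (hw s hs.1).hasDerivWithinAt) ?_ hβ ?_ ⟨ht, le_rfl⟩
  · have : 0 ≤ M * D / δ ^ 2 := by positivity
    simp only [sub_self, mul_zero, Real.exp_zero, mul_one]
    linarith
  · intro s hs hs'
    rw [hs']
    have h₁ : a s * e s ≤ |a s| * D :=
      (le_abs_self _).trans <| (abs_mul _ _).le.trans <|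
        mul_le_mul_of_nonneg_left (he s hs.1) (abs_nonneg _)
    have hδa := haδ s hs.1
    have h₂ : δ ^ 2 ≤ a s ^ 2 := by
      rw [← sq_abs (a s)]
      gcongr
    have h₃ : |a s| * D ≤ a s ^ 2 * (M * D / δ ^ 2) := by
      rw [← mul_div_assoc, le_div_iff₀ (by positivity), ← sq_abs (a s)]
      have h : δ * δ ≤ |a s| * M :=
        mul_le_mul hδa (hδa.trans (haM s hs.1)) hδ.le (abs_nonneg _)
      calc |a s| * D * δ ^ 2 = (|a s| * D) * (δ * δ) := by ring
        _ ≤ (|a s| * D) * (|a s| * M) := by gcongr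
        _ = |a s| ^ 2 * (M * D) := by ring
    have hE : 0 ≤ C * Real.exp (-(γ * δ ^ 2) * (s - t₀)) := by positivity
    generalize C * Real.exp (-(γ * δ ^ 2) * (s - t₀)) = E at hE ⊢
    have h₄ : δ ^ 2 * E ≤ a s ^ 2 * E := by gcongr
    have h₅ : 0 < a s ^ 2 * ε := mul_pos (lt_of_lt_of_le (by positivity) h₂) hε
    have h₆ : 0 < γ * (a s ^ 2 * (M * D / δ ^ 2 + ε + E) - a s * e s - δ ^ 2 * E) :=
      mul_pos hγ (by linarith)
    linarith

/-- Robustness of the scalar DREM estimator: if `|Δ| ≤ M` on `[0,∞)`,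
`|Δ| ≥ δ > 0` on `[t_d,∞)`, `|d| ≤ d̄`, and `z' = −γΔ²z + γΔd`, then `z` is
bounded on `[0,∞)` and `limsup_{t→∞} |z(t)| ≤ M d̄ / δ²`. -/
theorem scalar_drem_robustness
    (γ δ M dbar td : ℝ) (hγ : 0 < γ) (hδ : 0 < δ) (hM : 0 < M)
    (hdbar : 0 ≤ dbar) (htd : 0 ≤ td)
    (Δ d : ℝ → ℝ) (hΔc : Continuous Δ) (hdc : Continuous d)
    (hΔM : ∀ t ≥ (0:ℝ), |Δ t| ≤ M)
    (hΔδ : ∀ t ≥ td, δ ≤ |Δ t|)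
    (hd : ∀ t ≥ (0:ℝ), |d t| ≤ dbar)
    (z : ℝ → ℝ)
    (hz : ∀ t ≥ (0:ℝ), HasDerivAt z (-γ * (Δ t) ^ 2 * z t + γ * Δ t * d t) t) :
    (∃ K : ℝ, ∀ t ≥ (0:ℝ), |z t| ≤ K) ∧
    Filter.limsup (fun t => |z t|) Filter.atTop ≤ M * dbar / δ ^ 2 := by
  have bound {ε : ℝ} (hε : 0 < ε) {t : ℝ} (ht : td ≤ t) :
      |z t| ≤ M * dbar / δ ^ 2 + ε + |z td| * Real.exp (-(γ * δ ^ 2) * (t - td)) := by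
    have hΔM' : ∀ t ≥ td, |Δ t| ≤ M := fun t ht => hΔM t (htd.trans ht)
    refine abs_le'.2 ⟨?_, ?_⟩
    · exact le_add_exp_of_hasDerivAt_linear hγ hδ hdbar (abs_nonneg _) hε hΔM' hΔδ
        (fun t ht => hd t (htd.trans ht)) (fun t ht => hz t (htd.trans ht)) (le_abs_self _) ht
    · refine le_add_exp_of_hasDerivAt_linear (w := fun t => -z t) (e := fun t => -d t)
        hγ hδ hdbar (abs_nonneg _) hε hΔM' hΔδ
        (fun t ht => (abs_neg _).trans_le (hd t (htd.trans ht))) (fun t ht => ?_)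
        (neg_le_abs _) ht
      exact (hz t (htd.trans ht)).fun_neg.congr_deriv (by ring)
  refine ⟨?_, ?_⟩
  · obtain ⟨K, hK⟩ := (isCompact_Icc (a := (0 : ℝ)) (b := td)).exists_bound_of_continuousOn
      (f := z) fun t ht => (hz t ht.1).continuousAt.continuousWithinAt
    refine ⟨max K (M * dbar / δ ^ 2 + 1 + |z td|), fun t ht => ?_⟩
    rcases le_total t td with h | h
    · exact le_max_of_le_left (hK t ⟨ht, h⟩)
    · refine le_max_of_le_right ((bound one_pos h).trans ?_)
      gcongr
      refine mul_le_of_le_one_right (abs_nonneg _) (Real.exp_le_one_iff.2 ?_)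
      have : 0 ≤ γ * δ ^ 2 * (t - td) := mul_nonneg (by positivity) (sub_nonneg.2 h)
      linarith
  · refine le_of_forall_pos_le_add fun ε hε => ?_
    have hlim : Filter.Tendsto
        (fun t => |z td| * Real.exp (-(γ * δ ^ 2) * (t - td))) Filter.atTop (nhds 0) := by
      rw [← mul_zero |z td|]
      refine (Real.tendsto_exp_atBot.comp ?_).const_mul _
      exact (Filter.tendsto_atTop_add_const_right _ (-td) Filter.tendsto_id).const_mul_atTop_of_neg
        (neg_lt_zero.2 (by positivity))
    refine Filter.limsup_le_of_le
      (Filter.isCoboundedUnder_le_of_le _ (x := 0) fun t => abs_nonneg _) ?_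
    filter_upwards [hlim.eventually_lt_const (half_pos hε), Filter.eventually_ge_atTop td]
      with t h₁ h₂
    linarith [bound (half_pos hε) h₂]
end
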